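/- arXiv:2304.10915 — 2 statements merged into one kernel-verified Lean document; each statement's English description precedes it below -/
import Mathlib

section
/- ⊽-disjunctive normal form for TeamLTL^l(⊽): every TeamLTL(⊽)-formula φ is equivalent under lax team semantics (satisfied by exactly the same teams) to a formula ⊽_{i∈I} αᵢ in which each αᵢ is an LTL-formula (⊽-free) whose length is at most the length of φ, and |I| = 2^k where k is the number of occurrences of ⊽ in φ. Concretely, φ is equivalent to ⊽_{f∈F} φ^f, where F is the set of functions selecting, for each occurrence of a subformula ψ⊽θ of φ, either ψ or θ, and φ^f is obtained from φ by substituting each such occurrence by the selected disjunct. -/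
namespace TeamLTL

/-- A trace over atomic propositions `AP` is an infinite sequence of sets of propositions. -/
abbrev Trace (AP : Type) := ℕ → Set AP

/-- `t[i,∞]`, the suffix of a trace. -/
def Trace.suffix {AP : Type} (t : Trace AP) (i : ℕ) : Trace AP := fun j => t (i + j)

/-- A team is a set of traces. -/
abbrev Team (AP : Type) := Set (Trace AP)

/-- `T[f,∞] = { t[s,∞] : t ∈ T, s ∈ f t }` for `f : T → P(ℕ)⁺`. -/
def Team.update {AP : Type} (T : Team AP) (f : Trace AP → Set ℕ) : Team AP :=
  { s | ∃ t ∈ T, ∃ i ∈ f t, s = Trace.suffix t i }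

/-- `f` maps every trace of `T` to a nonempty set of naturals (i.e. `f : T → P(ℕ)⁺`). -/
def properOn {AP : Type} (T : Team AP) (f : Trace AP → Set ℕ) : Prop :=
  ∀ t ∈ T, (f t).Nonempty

/-- `f' < f` on the team `T'`: for all `t ∈ T'`, `min (f' t) ≤ min (f t)` and whenever
`f t` has a maximum, `f' t` has a maximum which is strictly smaller. -/
def funLT {AP : Type} (T' : Team AP) (f' f : Trace AP → Set ℕ) : Prop :=
  ∀ t ∈ T', sInf (f' t) ≤ sInf (f t) ∧
    ∀ m, IsGreatest (f t) m → ∃ m', IsGreatest (f' t) m' ∧ m' < m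

/-- Formulae of TeamLTL, together with the Boolean disjunction `bor` (⊽) and the
Boolean negation `bneg` (∼).  Plain TeamLTL-formulae (= LTL-formulae in negation
normal form) are those satisfying `isLTL` below. -/
inductive Formula (AP : Type) : Type
  | atom  : AP → Formula AP
  | natom : AP → Formula AP
  | conj  : Formula AP → Formula AP → Formula AP
  | disj  : Formula AP → Formula AP → Formula AP
  | next  : Formula AP → Formula AP
  | glob  : Formula AP → Formula AP
  | untl  : Formula AP → Formula AP → Formula AP
  | bor   : Formula AP → Formula AP → Formula AP
  | bneg  : Formula AP → Formula AP

/-- Lax team semantics `T ⊨ˡ φ`. -/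
def laxSat {AP : Type} : Formula AP → Team AP → Prop
  | .atom p, T => ∀ t ∈ T, p ∈ t 0
  | .natom p, T => ∀ t ∈ T, p ∉ t 0
  | .conj φ ψ, T => laxSat φ T ∧ laxSat ψ T
  | .disj φ ψ, T => ∃ T₁ T₂ : Team AP, T = T₁ ∪ T₂ ∧ laxSat φ T₁ ∧ laxSat ψ T₂
  | .next φ, T => laxSat φ (Team.update T (fun _ => {1}))
  | .glob φ, T => ∀ f, properOn T f → laxSat φ (Team.update T f)
  | .untl φ ψ, T => ∃ f, properOn T f ∧ laxSat ψ (Team.update T f) ∧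
      ({t ∈ T | f t ≠ ({0} : Set ℕ)} = ∅ ∨
        ∀ f', properOn {t ∈ T | f t ≠ ({0} : Set ℕ)} f' →
          funLT {t ∈ T | f t ≠ ({0} : Set ℕ)} f' f →
          laxSat φ (Team.update {t ∈ T | f t ≠ ({0} : Set ℕ)} f'))
  | .bor φ ψ, T => laxSat φ T ∨ laxSat ψ T
  | .bneg φ, T => ¬ laxSat φ T

/-- Classical LTL semantics on a single trace. -/
def traceSat {AP : Type} : Formula AP → Trace AP → Prop
  | .atom p, t => p ∈ t 0
  | .natom p, t => p ∉ t 0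
  | .conj φ ψ, t => traceSat φ t ∧ traceSat ψ t
  | .disj φ ψ, t => traceSat φ t ∨ traceSat ψ t
  | .next φ, t => traceSat φ (Trace.suffix t 1)
  | .glob φ, t => ∀ i, traceSat φ (Trace.suffix t i)
  | .untl φ ψ, t => ∃ i, traceSat ψ (Trace.suffix t i) ∧ ∀ j < i, traceSat φ (Trace.suffix t j)
  | .bor φ ψ, t => traceSat φ t ∨ traceSat ψ t
  | .bneg φ, t => ¬ traceSat φ t

/-- `φ` is a plain LTL-formula (no ⊽ and no ∼). -/
def Formula.isLTL {AP : Type} : Formula AP → Prop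
  | .atom _ => True
  | .natom _ => True
  | .conj φ ψ => φ.isLTL ∧ ψ.isLTL
  | .disj φ ψ => φ.isLTL ∧ ψ.isLTL
  | .next φ => φ.isLTL
  | .glob φ => φ.isLTL
  | .untl φ ψ => φ.isLTL ∧ ψ.isLTL
  | .bor _ _ => False
  | .bneg _ => False

/-- `φ` is a TeamLTL(⊽)-formula (no Boolean negation ∼). -/
def Formula.noBneg {AP : Type} : Formula AP → Prop
  | .atom _ => True
  | .natom _ => True
  | .conj φ ψ => φ.noBneg ∧ ψ.noBneg
  | .disj φ ψ => φ.noBneg ∧ ψ.noBneg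
  | .next φ => φ.noBneg
  | .glob φ => φ.noBneg
  | .untl φ ψ => φ.noBneg ∧ ψ.noBneg
  | .bor φ ψ => φ.noBneg ∧ ψ.noBneg
  | .bneg _ => False

/-- `φ` is a TeamLTL(∼)-formula (no Boolean disjunction ⊽). -/
def Formula.noBor {AP : Type} : Formula AP → Prop
  | .atom _ => True
  | .natom _ => True
  | .conj φ ψ => φ.noBor ∧ ψ.noBor
  | .disj φ ψ => φ.noBor ∧ ψ.noBor
  | .next φ => φ.noBor
  | .glob φ => φ.noBor
  | .untl φ ψ => φ.noBor ∧ ψ.noBor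
  | .bor _ _ => False
  | .bneg φ => φ.noBor

/-- Left-flatness: in every subformula `G ψ` and `ψ U θ`, `ψ` is an LTL-formula;
moreover `φ` is a TeamLTL(⊽)-formula (no ∼). -/
def Formula.leftFlat {AP : Type} : Formula AP → Prop
  | .atom _ => True
  | .natom _ => True
  | .conj φ ψ => φ.leftFlat ∧ ψ.leftFlat
  | .disj φ ψ => φ.leftFlat ∧ ψ.leftFlat
  | .next φ => φ.leftFlat
  | .glob φ => φ.isLTL
  | .untl φ ψ => φ.isLTL ∧ ψ.leftFlat
  | .bor φ ψ => φ.leftFlat ∧ ψ.leftFlat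
  | .bneg _ => False

/-- Left-downward closure: in every subformula `G ψ` and `ψ U θ`, `ψ` is a
TeamLTL(⊽)-formula (contains no ∼). -/
def Formula.leftDC {AP : Type} : Formula AP → Prop
  | .atom _ => True
  | .natom _ => True
  | .conj φ ψ => φ.leftDC ∧ ψ.leftDC
  | .disj φ ψ => φ.leftDC ∧ ψ.leftDC
  | .next φ => φ.leftDC
  | .glob φ => φ.noBneg
  | .untl φ ψ => φ.noBneg ∧ ψ.leftDC
  | .bor φ ψ => φ.leftDC ∧ ψ.leftDC
  | .bneg φ => φ.leftDC

/-- Length (size) of a formula. -/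
def Formula.size {AP : Type} : Formula AP → ℕ
  | .atom _ => 1
  | .natom _ => 1
  | .conj φ ψ => φ.size + ψ.size + 1
  | .disj φ ψ => φ.size + ψ.size + 1
  | .next φ => φ.size + 1
  | .glob φ => φ.size + 1
  | .untl φ ψ => φ.size + ψ.size + 1
  | .bor φ ψ => φ.size + ψ.size + 1
  | .bneg φ => φ.size + 1

/-- Number of occurrences of the Boolean disjunction ⊽ in a formula. -/
def Formula.borCount {AP : Type} : Formula AP → ℕ
  | .atom _ => 0
  | .natom _ => 0
  | .conj φ ψ => φ.borCount + ψ.borCount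
  | .disj φ ψ => φ.borCount + ψ.borCount
  | .next φ => φ.borCount
  | .glob φ => φ.borCount
  | .untl φ ψ => φ.borCount + ψ.borCount
  | .bor φ ψ => φ.borCount + ψ.borCount + 1
  | .bneg φ => φ.borCount

/-- Boolean disjunction `⊽` of a nonempty list of formulae (head plus tail). -/
def disjOf {AP : Type} : Formula AP → List (Formula AP) → Formula AP
  | a, [] => a
  | a, b :: l => .bor a (disjOf b l)

/-- Conjunction `a ∧ ⋀ l` of a formula with a (possibly empty) list of formulae. -/
def conjAnd {AP : Type} (a : Formula AP) : List (Formula AP) → Formula AP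
  | [] => a
  | b :: l => .conj (conjAnd a l) b

/-- Some atomic proposition occurring in a formula. -/
def Formula.someAtom {AP : Type} : Formula AP → AP
  | .atom p => p
  | .natom p => p
  | .conj φ _ => φ.someAtom
  | .disj φ _ => φ.someAtom
  | .next φ => φ.someAtom
  | .glob φ => φ.someAtom
  | .untl φ _ => φ.someAtom
  | .bor φ _ => φ.someAtom
  | .bneg φ => φ.someAtom

/-- The dual `φ^d`: the negation normal form of `¬φ` (for LTL-formulae `φ`).
`¬Gφ` is rewritten as `⊤ U ¬φ` and `¬(φUψ)` as `(¬ψ U (¬φ ∧ ¬ψ)) ∨ G¬ψ`. -/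
def Formula.dual {AP : Type} : Formula AP → Formula AP
  | .atom p => .natom p
  | .natom p => .atom p
  | .conj φ ψ => .disj φ.dual ψ.dual
  | .disj φ ψ => .conj φ.dual ψ.dual
  | .next φ => .next φ.dual
  | .glob φ => .untl (.disj (.atom φ.someAtom) (.natom φ.someAtom)) φ.dual
  | .untl φ ψ => .disj (.untl ψ.dual (.conj φ.dual ψ.dual)) (.glob ψ.dual)
  | .bor φ ψ => .conj φ.dual ψ.dual
  | .bneg φ => φ

/-- `∃β`, an abbreviation for `∼β^d`: it holds in a team `T` iff some trace of `T`
satisfies `β` classically. -/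
def Formula.exi {AP : Type} (β : Formula AP) : Formula AP := .bneg β.dual

end TeamLTL

namespace TeamLTL

variable {AP : Type}

theorem Team.update_mono {S T : Team AP} {f g : Trace AP → Set ℕ} (hST : S ⊆ T)
    (hfg : ∀ t ∈ S, f t ⊆ g t) : Team.update S f ⊆ Team.update T g := by
  rintro _ ⟨t, ht, i, hi, rfl⟩
  exact ⟨t, hST ht, i, hfg t ht hi, rfl⟩

/-- A maximum of a set of naturals other than `{0}` is positive. -/
theorem pos_of_isGreatest_of_ne_zero {A : Set ℕ} (hA : A ≠ {0}) {m : ℕ} (hm : IsGreatest A m) :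
    0 < m := by
  rcases Nat.eq_zero_or_pos m with rfl | h
  · exact absurd (Set.eq_singleton_iff_unique_mem.2
      ⟨hm.1, fun x hx => Nat.le_zero.1 (hm.2 hx)⟩) hA
  · exact h

/-- TeamLTL(⊽)-formulae are downward closed under lax semantics. -/
theorem Formula.noBneg.laxSat_mono {φ : Formula AP} (hφ : φ.noBneg) {S T : Team AP}
    (hST : S ⊆ T) (hT : laxSat φ T) : laxSat φ S := by
  induction φ generalizing S T with
  | atom p => exact fun t ht => hT t (hST ht)
  | natom p => exact fun t ht => hT t (hST ht)
  | conj φ ψ ihφ ihψ => exact ⟨ihφ hφ.1 hST hT.1, ihψ hφ.2 hST hT.2⟩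
  | disj φ ψ ihφ ihψ =>
    obtain ⟨T₁, T₂, rfl, h₁, h₂⟩ := hT
    refine ⟨S ∩ T₁, S ∩ T₂, ?_, ihφ hφ.1 Set.inter_subset_right h₁,
      ihψ hφ.2 Set.inter_subset_right h₂⟩
    rw [← Set.inter_union_distrib_left, Set.inter_eq_left.2 hST]
  | next φ ih => exact ih hφ (Team.update_mono hST fun _ _ => subset_rfl) hT
  | glob φ ih =>
    intro f hf
    exact ih hφ (Team.update_mono hST fun _ _ => Set.subset_univ _)
      (hT (fun _ => Set.univ) fun _ _ => Set.univ_nonempty)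
  | untl φ ψ ihφ ihψ =>
    classical
    obtain ⟨f, hf, hψ, h⟩ := hT
    have hsub : {t ∈ S | f t ≠ ({0} : Set ℕ)} ⊆ {t ∈ T | f t ≠ ({0} : Set ℕ)} :=
      fun t ht => ⟨hST ht.1, ht.2⟩
    refine ⟨f, fun t ht => hf t (hST ht),
      ihψ hφ.2 (Team.update_mono hST fun _ _ => subset_rfl) hψ, ?_⟩
    rcases h with h | h
    · exact Or.inl (Set.subset_eq_empty hsub h)
    · refine Or.inr fun g hg hlt => ?_
      refine ihφ hφ.1 (Team.update_mono hsub fun t ht => ?_)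
        (h (fun t => if t ∈ S then g t else {0}) (fun t ht => ?_) fun t ht => ?_)
      · simp [ht.1]
      · by_cases hS : t ∈ S
        · simpa [hS] using hg t ⟨hS, ht.2⟩
        · simp [hS]
      · by_cases hS : t ∈ S
        · simpa [hS] using hlt t ⟨hS, ht.2⟩
        · simp only [hS, if_false]
          exact ⟨by simp, fun m hm =>
            ⟨0, isGreatest_singleton, pos_of_isGreatest_of_ne_zero ht.2 hm⟩⟩
  | bor φ ψ ihφ ihψ => exact hT.imp (ihφ hφ.1 hST) (ihψ hφ.2 hST)
  | bneg φ => exact hφ.elim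

theorem Formula.isLTL.noBneg {φ : Formula AP} (h : φ.isLTL) : φ.noBneg := by
  induction φ with
  | atom | natom => trivial
  | conj _ _ ih₁ ih₂ | disj _ _ ih₁ ih₂ | untl _ _ ih₁ ih₂ => exact ⟨ih₁ h.1, ih₂ h.2⟩
  | next _ ih | glob _ ih => exact ih h
  | bor | bneg => exact h.elim

/-- The functions strictly below `f` are closed under pointwise union. -/
theorem funLT.union {T : Team AP} {f g₁ g₂ : Trace AP → Set ℕ} (hg₁ : properOn T g₁)
    (h₁ : funLT T g₁ f) (h₂ : funLT T g₂ f) : funLT T (fun t => g₁ t ∪ g₂ t) f := by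
  refine fun t ht => ⟨?_, fun m hm => ?_⟩
  · exact (Nat.sInf_le (Or.inl (Nat.sInf_mem (hg₁ t ht)))).trans (h₁ t ht).1
  · obtain ⟨m₁, hm₁, hlt₁⟩ := (h₁ t ht).2 m hm
    obtain ⟨m₂, hm₂, hlt₂⟩ := (h₂ t ht).2 m hm
    exact ⟨max m₁ m₂, hm₁.union hm₂, max_lt hlt₁ hlt₂⟩

/-- If finitely many antitone properties cover a nonempty directed family, then one of them
holds on the whole family. -/
theorem exists_forall_of_directed {ι β : Type*} {P : ι → Prop} {Q : β → ι → Prop} {l : List β}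
    (hne : ∃ i, P i)
    (hdir : ∀ i j, P i → P j → ∃ k, P k ∧ ∀ x ∈ l, Q x k → Q x i ∧ Q x j)
    (hcov : ∀ i, P i → ∃ x ∈ l, Q x i) : ∃ x ∈ l, ∀ i, P i → Q x i := by
  induction l with
  | nil =>
    obtain ⟨i, hi⟩ := hne
    simpa using hcov i hi
  | cons x l ih =>
    by_cases hx : ∀ i, P i → Q x i
    · exact ⟨x, List.mem_cons_self, hx⟩
    push Not at hx
    obtain ⟨i₀, hi₀, hQ⟩ := hx
    obtain ⟨y, hy, h⟩ := ih
      (fun i j hi hj => (hdir i j hi hj).imp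
        fun k hk => ⟨hk.1, fun y hy => hk.2 y (List.mem_cons_of_mem _ hy)⟩)
      fun i hi => by
        obtain ⟨k, hk, hdown⟩ := hdir i i₀ hi hi₀
        obtain ⟨y, hy, hyk⟩ := hcov k hk
        rcases List.mem_cons.1 hy with rfl | hyl
        · exact absurd (hdown _ hy hyk).2 hQ
        · exact ⟨y, hyl, (hdown y hy hyk).1⟩
    exact ⟨y, List.mem_cons_of_mem _ hy, h⟩

theorem laxSat_disjOf (a : Formula AP) (l : List (Formula AP)) (T : Team AP) :
    laxSat (disjOf a l) T ↔ ∃ β ∈ a :: l, laxSat β T := by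
  induction l generalizing a with
  | nil => simp [disjOf]
  | cons b l ih =>
    rw [List.exists_mem_cons_iff, ← ih b]
    rfl

/-- The list of all formulae `φ^f`, where `f` selects a disjunct for each occurrence of `⊽`
in `φ`. -/
def Formula.selections : Formula AP → List (Formula AP)
  | .atom p => [.atom p]
  | .natom p => [.natom p]
  | .conj φ ψ => (φ.selections ×ˢ ψ.selections).map fun p => .conj p.1 p.2
  | .disj φ ψ => (φ.selections ×ˢ ψ.selections).map fun p => .disj p.1 p.2
  | .next φ => φ.selections.map .next
  | .glob φ => φ.selections.map .glob
  | .untl φ ψ => (φ.selections ×ˢ ψ.selections).map fun p => .untl p.1 p.2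
  | .bor φ ψ => (φ.selections ×ˢ ψ.selections).map Prod.fst ++
      (φ.selections ×ˢ ψ.selections).map Prod.snd
  | .bneg φ => φ.selections.map .bneg

theorem Formula.length_selections (φ : Formula AP) :
    φ.selections.length = 2 ^ φ.borCount := by
  induction φ with
  | atom | natom => rfl
  | conj _ _ ih₁ ih₂ | disj _ _ ih₁ ih₂ | untl _ _ ih₁ ih₂ =>
    simp [selections, borCount, List.length_product, ih₁, ih₂, pow_add]
  | next _ ih | glob _ ih | bneg _ ih => simp [selections, borCount, ih]
  | bor _ _ ih₁ ih₂ =>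
    simp [selections, borCount, List.length_product, ih₁, ih₂, pow_add, mul_two]

theorem Formula.exists_mem_selections (φ : Formula AP) : ∃ β, β ∈ φ.selections :=
  List.exists_mem_of_length_pos (by simp [length_selections])

theorem Formula.size_le_of_mem_selections {φ β : Formula AP} (h : β ∈ φ.selections) :
    β.size ≤ φ.size := by
  induction φ generalizing β with
  | atom | natom =>
    obtain rfl := List.mem_singleton.1 h
    rfl
  | conj _ _ ih₁ ih₂ | disj _ _ ih₁ ih₂ | untl _ _ ih₁ ih₂ =>
    obtain ⟨⟨a, b⟩, hab, rfl⟩ := List.mem_map.1 h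
    replace hab := List.pair_mem_product.1 hab
    have := ih₁ hab.1
    have := ih₂ hab.2
    simp only [size]
    omega
  | next _ ih | glob _ ih | bneg _ ih =>
    obtain ⟨a, ha, rfl⟩ := List.mem_map.1 h
    exact Nat.succ_le_succ (ih ha)
  | bor _ _ ih₁ ih₂ =>
    simp only [size]
    rcases List.mem_append.1 h with h | h <;> obtain ⟨⟨a, b⟩, hab, rfl⟩ := List.mem_map.1 h <;>
      replace hab := List.pair_mem_product.1 hab
    · exact (ih₁ hab.1).trans (by omega)
    · exact (ih₂ hab.2).trans (by omega)

theorem Formula.noBneg.isLTL_of_mem_selections {φ β : Formula AP} (hφ : φ.noBneg)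
    (h : β ∈ φ.selections) : β.isLTL := by
  induction φ generalizing β with
  | atom | natom =>
    obtain rfl := List.mem_singleton.1 h
    trivial
  | conj _ _ ih₁ ih₂ | disj _ _ ih₁ ih₂ | untl _ _ ih₁ ih₂ =>
    obtain ⟨⟨a, b⟩, hab, rfl⟩ := List.mem_map.1 h
    replace hab := List.pair_mem_product.1 hab
    exact ⟨ih₁ hφ.1 hab.1, ih₂ hφ.2 hab.2⟩
  | next _ ih | glob _ ih =>
    obtain ⟨a, ha, rfl⟩ := List.mem_map.1 h
    exact ih (β := a) hφ ha
  | bor _ _ ih₁ ih₂ =>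
    rcases List.mem_append.1 h with h | h <;> obtain ⟨⟨a, b⟩, hab, rfl⟩ := List.mem_map.1 h <;>
      replace hab := List.pair_mem_product.1 hab
    · exact ih₁ hφ.1 hab.1
    · exact ih₂ hφ.2 hab.2
  | bneg => exact hφ.elim

theorem exists_mem_map_product_iff {β γ δ : Type*} {l₁ : List β} {l₂ : List γ}
    {F : β × γ → δ} {Q : δ → Prop} :
    (∃ d ∈ (l₁ ×ˢ l₂).map F, Q d) ↔ ∃ a ∈ l₁, ∃ b ∈ l₂, Q (F (a, b)) := by
  constructor
  · rintro ⟨_, h, hQ⟩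
    obtain ⟨⟨a, b⟩, hab, rfl⟩ := List.mem_map.1 h
    replace hab := List.pair_mem_product.1 hab
    exact ⟨a, hab.1, b, hab.2, hQ⟩
  · rintro ⟨a, ha, b, hb, hQ⟩
    exact ⟨_, List.mem_map_of_mem (List.pair_mem_product.2 ⟨ha, hb⟩), hQ⟩

/-- In `φ U ψ`, finitely many alternatives for the left argument can be chosen uniformly. -/
theorem exists_forall_funLT {T : Team AP} {f : Trace AP → Set ℕ} {l : List (Formula AP)}
    (hl : ∀ β ∈ l, β.noBneg) (hf : ∀ t ∈ T, f t ≠ {0})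
    (h : ∀ g, properOn T g → funLT T g f → ∃ β ∈ l, laxSat β (Team.update T g)) :
    ∃ β ∈ l, ∀ g, properOn T g → funLT T g f → laxSat β (Team.update T g) := by
  obtain ⟨β, hβ, H⟩ := exists_forall_of_directed (P := fun g => properOn T g ∧ funLT T g f)
    (Q := fun β g => laxSat β (Team.update T g)) (l := l)
    ⟨fun _ => {0}, fun _ _ => Set.singleton_nonempty 0, fun t ht => ⟨by simp, fun m hm =>
      ⟨0, isGreatest_singleton, pos_of_isGreatest_of_ne_zero (hf t ht) hm⟩⟩⟩
    (fun g₁ g₂ h₁ h₂ => ⟨fun t => g₁ t ∪ g₂ t,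
      ⟨fun t ht => (h₁.1 t ht).inl, h₁.2.union h₁.1 h₂.2⟩,
      fun β hβ hsat =>
        ⟨(hl β hβ).laxSat_mono (Team.update_mono subset_rfl fun _ _ => Set.subset_union_left) hsat,
          (hl β hβ).laxSat_mono
            (Team.update_mono subset_rfl fun _ _ => Set.subset_union_right) hsat⟩⟩)
    fun g hg => h g hg.1 hg.2
  exact ⟨β, hβ, fun g hg hlt => H g ⟨hg, hlt⟩⟩

/-- A TeamLTL(⊽)-formula `φ` is equivalent to the Boolean disjunction of all its `φ^f`. -/
theorem Formula.noBneg.laxSat_iff_exists_selections {φ : Formula AP} (hφ : φ.noBneg)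
    (T : Team AP) : laxSat φ T ↔ ∃ β ∈ φ.selections, laxSat β T := by
  induction φ generalizing T with
  | atom | natom => simp [selections]
  | conj φ ψ ihφ ihψ =>
    rw [selections, exists_mem_map_product_iff]
    simp only [laxSat, ihφ hφ.1, ihψ hφ.2]
    grind
  | disj φ ψ ihφ ihψ =>
    rw [selections, exists_mem_map_product_iff]
    simp only [laxSat, ihφ hφ.1, ihψ hφ.2]
    constructor
    · rintro ⟨T₁, T₂, h, ⟨a, ha, h₁⟩, b, hb, h₂⟩
      exact ⟨a, ha, b, hb, T₁, T₂, h, h₁, h₂⟩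
    · rintro ⟨a, ha, b, hb, T₁, T₂, h, h₁, h₂⟩
      exact ⟨T₁, T₂, h, ⟨a, ha, h₁⟩, b, hb, h₂⟩
  | next φ ih => simp [selections, laxSat, ih hφ]
  | glob φ ih =>
    simp only [selections, List.mem_map, exists_exists_and_eq_and, laxSat, ih hφ]
    constructor
    · intro h
      obtain ⟨a, ha, hsat⟩ := h (fun _ => Set.univ) fun _ _ => Set.univ_nonempty
      exact ⟨a, ha, fun f _ => (isLTL_of_mem_selections (φ := φ) hφ ha).noBneg.laxSat_mono
        (Team.update_mono subset_rfl fun _ _ => Set.subset_univ _) hsat⟩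
    · rintro ⟨a, ha, h⟩ f hf
      exact ⟨a, ha, h f hf⟩
  | untl φ ψ ihφ ihψ =>
    rw [selections, exists_mem_map_product_iff]
    simp only [laxSat, ihφ hφ.1, ihψ hφ.2]
    constructor
    · rintro ⟨f, hf, ⟨b, hb, hψ⟩, h | h⟩
      · obtain ⟨a, ha⟩ := φ.exists_mem_selections
        exact ⟨a, ha, b, hb, f, hf, hψ, Or.inl h⟩
      · obtain ⟨a, ha, H⟩ := exists_forall_funLT
          (fun β hβ => (isLTL_of_mem_selections hφ.1 hβ).noBneg) (fun t ht => ht.2) h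
        exact ⟨a, ha, b, hb, f, hf, hψ, Or.inr H⟩
    · rintro ⟨a, ha, b, hb, f, hf, hψ, h⟩
      exact ⟨f, hf, ⟨b, hb, hψ⟩, h.imp_right fun h g hg hlt => ⟨a, ha, h g hg hlt⟩⟩
  | bor φ ψ ihφ ihψ =>
    obtain ⟨a, ha⟩ := φ.exists_mem_selections
    obtain ⟨b, hb⟩ := ψ.exists_mem_selections
    simp only [selections, List.mem_append, or_and_right, exists_or, exists_mem_map_product_iff,
      laxSat, ihφ hφ.1, ihψ hφ.2]
    grind
  | bneg => exact hφ.elim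

/-- **⊽-disjunctive normal form** for TeamLTL^l(⊽): every TeamLTL(⊽)-formula `φ` is
equivalent under lax team semantics to a Boolean disjunction `⊽_{i∈I} αᵢ` of
LTL-formulae `αᵢ` with `|αᵢ| ≤ |φ|` and `|I| = 2^k`, `k` the number of
occurrences of ⊽ in `φ`. -/
theorem bor_disjunctive_normal_form {AP : Type} (φ : Formula AP) (hφ : φ.noBneg) :
    ∃ (α : Formula AP) (αs : List (Formula AP)),
      (∀ β ∈ α :: αs, β.isLTL ∧ β.size ≤ φ.size) ∧
      (α :: αs).length = 2 ^ φ.borCount ∧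
      ∀ T : Team AP, laxSat φ T ↔ laxSat (disjOf α αs) T := by
  obtain ⟨_, ha⟩ := φ.exists_mem_selections
  obtain ⟨α, αs, h⟩ := List.exists_cons_of_ne_nil (List.ne_nil_of_mem ha)
  refine ⟨α, αs, fun β hβ => ?_, ?_, fun T => ?_⟩
  · rw [← h] at hβ
    exact ⟨hφ.isLTL_of_mem_selections hβ, Formula.size_le_of_mem_selections hβ⟩
  · rw [← h, φ.length_selections]
  · rw [laxSat_disjOf, ← h, hφ.laxSat_iff_exists_selections]

end TeamLTL
end

section
/- Flat TeamLTL^l(⊽)-formulae are definable without ⊽: if a TeamLTL(⊽)-formula φ is flat under lax semantics (i.e. for every team T, T ⊨ˡ φ if and only if {t} ⊨ˡ φ for all t ∈ T), then there exists a ⊽-free TeamLTL-formula ψ such that for every team T: T ⊨ˡ φ if and only if T ⊨ˡ ψ. -/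
namespace TeamLTL

/-- `φ` is equivalent, under lax semantics, to the Boolean disjunction of the formulae in `A`,
each of them read flatly, that is, classically on every trace of the team. -/
def IsFlatDisjunction {AP : Type} (φ : Formula AP) (A : Set (Formula AP)) : Prop :=
  ∀ T : Team AP, laxSat φ T ↔ ∃ α ∈ A, ∀ t ∈ T, traceSat α t

namespace IsFlatDisjunction

variable {AP : Type} {φ ψ : Formula AP} {A B : Set (Formula AP)}

theorem conj (hφ : IsFlatDisjunction φ A) (hψ : IsFlatDisjunction ψ B) :
    IsFlatDisjunction (.conj φ ψ) (Set.image2 .conj A B) := by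
  intro T
  simp only [laxSat, hφ T, hψ T, Set.exists_mem_image2, traceSat]
  constructor
  · rintro ⟨⟨α, hα, h⟩, β, hβ, h'⟩
    exact ⟨α, hα, β, hβ, fun t ht => ⟨h t ht, h' t ht⟩⟩
  · rintro ⟨α, hα, β, hβ, h⟩
    exact ⟨⟨α, hα, fun t ht => (h t ht).1⟩, β, hβ, fun t ht => (h t ht).2⟩

theorem disj (hφ : IsFlatDisjunction φ A) (hψ : IsFlatDisjunction ψ B) :
    IsFlatDisjunction (.disj φ ψ) (Set.image2 .disj A B) := by
  intro T
  simp only [laxSat, hφ _, hψ _, Set.exists_mem_image2, traceSat]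
  constructor
  · rintro ⟨T₁, T₂, rfl, ⟨α, hα, h⟩, β, hβ, h'⟩
    exact ⟨α, hα, β, hβ, fun t ht => ht.imp (h t) (h' t)⟩
  · rintro ⟨α, hα, β, hβ, h⟩
    refine ⟨{t ∈ T | traceSat α t}, {t ∈ T | traceSat β t}, ?_,
      ⟨α, hα, fun t ht => ht.2⟩, β, hβ, fun t ht => ht.2⟩
    ext t
    have := h t
    simp only [Set.mem_union, Set.mem_ofPred_eq]
    tauto

theorem next (hφ : IsFlatDisjunction φ A) :
    IsFlatDisjunction (.next φ) (Formula.next '' A) := by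
  intro T
  simp only [laxSat, hφ _, Set.exists_mem_image, traceSat]
  refine exists_congr fun α => and_congr_right fun _ => ⟨fun h t ht => ?_, ?_⟩
  · exact h _ ⟨t, ht, 1, rfl, rfl⟩
  · rintro h _ ⟨t, ht, _, rfl, rfl⟩
    exact h t ht

theorem glob (hφ : IsFlatDisjunction φ A) :
    IsFlatDisjunction (.glob φ) (Formula.glob '' A) := by
  intro T
  simp only [laxSat, hφ _, Set.exists_mem_image, traceSat]
  constructor
  · intro h
    obtain ⟨α, hα, h⟩ := h (fun _ => Set.univ) fun _ _ => Set.univ_nonempty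
    exact ⟨α, hα, fun t ht i => h _ ⟨t, ht, i, trivial, rfl⟩⟩
  · rintro ⟨α, hα, h⟩ f -
    refine ⟨α, hα, ?_⟩
    rintro _ ⟨t, ht, i, -, rfl⟩
    exact h t ht i

theorem untl (hA : A.Nonempty) (hφ : IsFlatDisjunction φ A) (hψ : IsFlatDisjunction ψ B) :
    IsFlatDisjunction (.untl φ ψ) (Set.image2 .untl A B) := by
  intro T
  simp only [laxSat, hφ _, hψ _, Set.exists_mem_image2, traceSat]
  constructor
  · rintro ⟨f, hf, ⟨β, hβ, hfβ⟩, hT'⟩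
    obtain ⟨α, hα, hfα⟩ : ∃ α ∈ A, ∀ t ∈ T, f t ≠ {0} →
        ∀ j, (∀ m, IsGreatest (f t) m → j < m) → traceSat α (t.suffix j) := by
      rcases hT' with hT' | hT'
      · obtain ⟨α, hα⟩ := hA
        exact ⟨α, hα, fun t ht h0 => (Set.eq_empty_iff_forall_notMem.1 hT' t ⟨ht, h0⟩).elim⟩
      · have hzero : ∀ t, f t ≠ {0} → ∀ m, IsGreatest (f t) m → 0 < m := by
          intro t h0 m hm
          refine Nat.pos_of_ne_zero fun hm0 => h0 ?_
          subst hm0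
          exact Set.eq_singleton_iff_unique_mem.2 ⟨hm.1, fun i hi => Nat.le_zero.1 (hm.2 hi)⟩
        obtain ⟨α, hα, h⟩ := hT' (fun t => {j | ∀ m, IsGreatest (f t) m → j < m})
          (fun t ht => ⟨0, hzero t ht.2⟩) (by
            intro t ht
            refine ⟨(Nat.sInf_le (m := 0) (by exact hzero t ht.2)).trans (Nat.zero_le _), fun m hm => ?_⟩
            have hpos := hzero t ht.2 m hm
            refine ⟨m - 1, ⟨fun k hk => ?_, fun k hk => ?_⟩, by omega⟩
            · rw [hk.unique hm]
              omega
            · exact Nat.le_sub_one_of_lt (hk m hm))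
        exact ⟨α, hα, fun t ht h0 j hj => h _ ⟨t, ⟨ht, h0⟩, j, hj, rfl⟩⟩
    refine ⟨α, hα, β, hβ, fun t ht => ?_⟩
    by_cases h0 : f t = {0}
    · exact ⟨0, hfβ _ ⟨t, ht, 0, by simp [h0], rfl⟩, fun j hj => absurd hj (Nat.not_lt_zero j)⟩
    · obtain ⟨i, hi⟩ := hf t ht
      exact ⟨i, hfβ _ ⟨t, ht, i, hi, rfl⟩,
        fun j hj => hfα t ht h0 j fun m hm => hj.trans_le (hm.2 hi)⟩
  · rintro ⟨α, hα, β, hβ, h⟩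
    have h' : ∀ t, ∃ i, t ∈ T →
        traceSat β (t.suffix i) ∧ ∀ j < i, traceSat α (t.suffix j) := by
      intro t
      by_cases ht : t ∈ T
      · exact (h t ht).imp fun i hi _ => hi
      · exact ⟨0, fun h => (ht h).elim⟩
    choose i hi using h'
    refine ⟨fun t => {i t}, fun t _ => Set.singleton_nonempty _, ⟨β, hβ, ?_⟩,
      Or.inr fun f' _ hlt => ⟨α, hα, ?_⟩⟩
    · rintro _ ⟨t, ht, _, rfl, rfl⟩
      exact (hi t ht).1
    · rintro _ ⟨t, ht, j, hj, rfl⟩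
      obtain ⟨m, hm, hmi⟩ := (hlt t ht).2 (i t) isGreatest_singleton
      exact (hi t ht.1).2 j ((hm.2 hj).trans_lt hmi)

theorem bor (hφ : IsFlatDisjunction φ A) (hψ : IsFlatDisjunction ψ B) :
    IsFlatDisjunction (.bor φ ψ) (A ∪ B) := by
  intro T
  simp only [laxSat, hφ T, hψ T, Set.mem_union, or_and_right, exists_or]

end IsFlatDisjunction

theorem isFlatDisjunction_singleton {AP : Type} {φ : Formula AP} (hφ : φ.isLTL) :
    IsFlatDisjunction φ {φ} := by
  induction φ with
  | atom p => simp [IsFlatDisjunction, laxSat, traceSat]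
  | natom p => simp [IsFlatDisjunction, laxSat, traceSat]
  | conj φ ψ ihφ ihψ => simpa using (ihφ hφ.1).conj (ihψ hφ.2)
  | disj φ ψ ihφ ihψ => simpa using (ihφ hφ.1).disj (ihψ hφ.2)
  | next φ ih => simpa using (ih hφ).next
  | glob φ ih => simpa using (ih hφ).glob
  | untl φ ψ ihφ ihψ =>
    simpa using (ihφ hφ.1).untl (Set.singleton_nonempty φ) (ihψ hφ.2)
  | bor _ _ => exact hφ.elim
  | bneg _ => exact hφ.elim

/-- LTL-formulae are flat under lax semantics. -/
theorem laxSat_iff_forall_traceSat {AP : Type} {φ : Formula AP} (hφ : φ.isLTL) (T : Team AP) :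
    laxSat φ T ↔ ∀ t ∈ T, traceSat φ t := by
  simpa using isFlatDisjunction_singleton hφ T

/-- Every TeamLTL(⊽)-formula is equivalent to a finite Boolean disjunction of LTL-formulae. -/
theorem exists_finite_isFlatDisjunction {AP : Type} {φ : Formula AP} (hφ : φ.noBneg) :
    ∃ A : Set (Formula AP), A.Finite ∧ A.Nonempty ∧ (∀ α ∈ A, α.isLTL) ∧
      IsFlatDisjunction φ A := by
  induction φ with
  | atom p =>
    exact ⟨_, Set.finite_singleton _, Set.singleton_nonempty _, by simp [Formula.isLTL],
      isFlatDisjunction_singleton trivial⟩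
  | natom p =>
    exact ⟨_, Set.finite_singleton _, Set.singleton_nonempty _, by simp [Formula.isLTL],
      isFlatDisjunction_singleton trivial⟩
  | conj φ ψ ihφ ihψ =>
    obtain ⟨A, hA, hA', hAl, h⟩ := ihφ hφ.1
    obtain ⟨B, hB, hB', hBl, h'⟩ := ihψ hφ.2
    exact ⟨Set.image2 .conj A B, hA.image2 _ hB, hA'.image2 hB',
      Set.forall_mem_image2.2 fun α hα β hβ => ⟨hAl α hα, hBl β hβ⟩, h.conj h'⟩
  | disj φ ψ ihφ ihψ =>
    obtain ⟨A, hA, hA', hAl, h⟩ := ihφ hφ.1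
    obtain ⟨B, hB, hB', hBl, h'⟩ := ihψ hφ.2
    exact ⟨Set.image2 .disj A B, hA.image2 _ hB, hA'.image2 hB',
      Set.forall_mem_image2.2 fun α hα β hβ => ⟨hAl α hα, hBl β hβ⟩, h.disj h'⟩
  | next φ ih =>
    obtain ⟨A, hA, hA', hAl, h⟩ := ih hφ
    exact ⟨Formula.next '' A, hA.image _, hA'.image _, Set.forall_mem_image.2 hAl, h.next⟩
  | glob φ ih =>
    obtain ⟨A, hA, hA', hAl, h⟩ := ih hφ
    exact ⟨Formula.glob '' A, hA.image _, hA'.image _, Set.forall_mem_image.2 hAl, h.glob⟩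
  | untl φ ψ ihφ ihψ =>
    obtain ⟨A, hA, hA', hAl, h⟩ := ihφ hφ.1
    obtain ⟨B, hB, hB', hBl, h'⟩ := ihψ hφ.2
    exact ⟨Set.image2 .untl A B, hA.image2 _ hB, hA'.image2 hB',
      Set.forall_mem_image2.2 fun α hα β hβ => ⟨hAl α hα, hBl β hβ⟩, h.untl hA' h'⟩
  | bor φ ψ ihφ ihψ =>
    obtain ⟨A, hA, hA', hAl, h⟩ := ihφ hφ.1
    obtain ⟨B, hB, hB', hBl, h'⟩ := ihψ hφ.2
    exact ⟨_, hA.union hB, hA'.inl, fun α hα => hα.elim (hAl α) (hBl α), h.bor h'⟩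
  | bneg _ => exact hφ.elim

theorem exists_isLTL_traceSat_iff_exists_mem {AP : Type} {A : Set (Formula AP)}
    (hA : A.Finite) (hne : A.Nonempty) (hAl : ∀ α ∈ A, α.isLTL) :
    ∃ ψ : Formula AP, ψ.isLTL ∧ ∀ t, traceSat ψ t ↔ ∃ α ∈ A, traceSat α t := by
  induction A, hA using Set.Finite.induction_on with
  | empty => exact absurd hne Set.not_nonempty_empty
  | @insert α A _ _ ih =>
    have hα : α.isLTL := hAl α (Set.mem_insert α A)
    rcases A.eq_empty_or_nonempty with rfl | hA
    · exact ⟨α, hα, by simp⟩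
    · obtain ⟨ψ, hψ, h⟩ := ih hA fun β hβ => hAl β (Set.mem_insert_of_mem α hβ)
      exact ⟨.disj α ψ, ⟨hα, hψ⟩, fun t => by simp [traceSat, h]⟩

/-- Flat TeamLTL^l(⊽)-formulae are definable without ⊽: if the TeamLTL(⊽)-formula
`φ` is flat under lax semantics, then there is a ⊽-free TeamLTL-formula `ψ`
equivalent to it under lax team semantics. -/
theorem flat_bor_formula_definable_without_bor {AP : Type} (φ : Formula AP)
    (hφ : φ.noBneg)
    (hflat : ∀ T : Team AP, laxSat φ T ↔ ∀ t ∈ T, laxSat φ ({t} : Team AP)) :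
    ∃ ψ : Formula AP, ψ.isLTL ∧ ∀ T : Team AP, laxSat φ T ↔ laxSat ψ T := by
  obtain ⟨A, hA, hne, hAl, h⟩ := exists_finite_isFlatDisjunction hφ
  obtain ⟨ψ, hψ, hψA⟩ := exists_isLTL_traceSat_iff_exists_mem hA hne hAl
  refine ⟨ψ, hψ, fun T => ?_⟩
  rw [hflat T, laxSat_iff_forall_traceSat hψ]
  refine forall₂_congr fun t _ => ?_
  rw [h, hψA]
  simp

end TeamLTL
end
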